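/- Let V_{h,0} be a finite element space of continuous piecewise polynomials on a quasi-uniform triangulation of a bounded polygonal domain Ω ⊂ ℝ², vanishing on ∂Ω. Then the discrete Sobolev inequality ‖v_h‖_{L^∞(Ω)} ≤ C(1 + |ln h|)^{1/2} ‖v_h‖_{H¹(Ω)} holds for all v_h ∈ V_{h,0}, with C independent of h. -/

import Mathlib

open MeasureTheory Set

noncomputable section

/-- A quasi-uniform triangulation of `Ω ⊆ ℝ^d` with mesh size `h` and shape
regularity parameter `ρ`: the (closed) simplices cover `Ω̄`, each cell is a
nondegenerate `d`-simplex of diameter at most `h` containing a ball of radius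
`ρ h`. -/
def IsQuasiUniformMesh (d : ℕ) (Ω : Set (EuclideanSpace ℝ (Fin d)))
    (T : Finset (Finset (EuclideanSpace ℝ (Fin d)))) (h ρ : ℝ) : Prop :=
  (⋃ K ∈ T, convexHull ℝ (K : Set (EuclideanSpace ℝ (Fin d)))) = closure Ω ∧
  ∀ K ∈ T, K.card = d + 1 ∧
    AffineIndependent ℝ (fun v : (K : Set (EuclideanSpace ℝ (Fin d))) => (v : EuclideanSpace ℝ (Fin d))) ∧
    Metric.diam (convexHull ℝ (K : Set (EuclideanSpace ℝ (Fin d)))) ≤ h ∧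
    ∃ x, Metric.ball x (ρ * h) ⊆ convexHull ℝ (K : Set (EuclideanSpace ℝ (Fin d)))

/-- Membership in the Lagrange finite element space `V_{h,0}`: continuous,
piecewise polynomial of degree at most `k` on each cell, vanishing on `∂Ω`. -/
def MemFESpace (d k : ℕ) (Ω : Set (EuclideanSpace ℝ (Fin d)))
    (T : Finset (Finset (EuclideanSpace ℝ (Fin d))))
    (v : EuclideanSpace ℝ (Fin d) → ℝ) : Prop :=
  Continuous v ∧ (∀ x ∈ frontier Ω, v x = 0) ∧
  ∀ K ∈ T, ∃ p : MvPolynomial (Fin d) ℝ, p.totalDegree ≤ k ∧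
    ∀ x ∈ convexHull ℝ (K : Set (EuclideanSpace ℝ (Fin d))),
      v x = MvPolynomial.eval (fun i => x i) p

/-- The `H¹(Ω)` norm built from pointwise derivatives. -/
def h1Norm {d : ℕ} (Ω : Set (EuclideanSpace ℝ (Fin d)))
    (v : EuclideanSpace ℝ (Fin d) → ℝ) : ℝ :=
  Real.sqrt ((∫ x in Ω, (v x) ^ 2) + ∫ x in Ω, ‖fderiv ℝ v x‖ ^ 2)

lemma markov_one (k : ℕ) : ∃ C : ℝ, 1 ≤ C ∧ ∀ q : Polynomial ℝ, q.natDegree ≤ k → ∀ M : ℝ,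
    (∀ t ∈ Icc (0:ℝ) 1, |q.eval t| ≤ M) → |q.derivative.eval 0| ≤ C * M := by
  classical
  set s := Finset.range (k+1)
  set w : ℕ → ℝ := fun i => (i:ℝ) / (k+1) with hw
  have hinj : Set.InjOn w s := by
    intro a _ b _ hab
    have hk : (0:ℝ) < k + 1 := by positivity
    simp only [hw] at hab
    field_simp at hab
    exact_mod_cast hab
  refine ⟨1 + ∑ i ∈ s, |(Lagrange.basis s w i).derivative.eval 0|, ?_, ?_⟩
  · have : 0 ≤ ∑ i ∈ s, |(Lagrange.basis s w i).derivative.eval 0| :=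
      Finset.sum_nonneg fun i _ => abs_nonneg _
    linarith
  intro q hq M hM
  have hM0 : 0 ≤ M := (abs_nonneg _).trans (hM 0 (by simp))
  have hdeg : q.degree < (s.card : WithBot ℕ) := by
    refine lt_of_le_of_lt Polynomial.degree_le_natDegree ?_
    simp only [s, Finset.card_range]
    exact_mod_cast Nat.lt_succ_of_le hq
  have h1 := Lagrange.eq_interpolate hinj hdeg
  have h2 : q.derivative.eval 0 = ∑ i ∈ s, q.eval (w i) * (Lagrange.basis s w i).derivative.eval 0 := by
    conv_lhs => rw [h1]
    rw [Lagrange.interpolate_apply]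
    simp [Polynomial.eval_finsetSum]
  rw [h2]
  calc _ ≤ ∑ i ∈ s, |q.eval (w i) * (Lagrange.basis s w i).derivative.eval 0| :=
        Finset.abs_sum_le_sum_abs _ _
    _ ≤ ∑ i ∈ s, M * |(Lagrange.basis s w i).derivative.eval 0| := by
        refine Finset.sum_le_sum fun i hi => ?_
        rw [abs_mul]
        refine mul_le_mul_of_nonneg_right (hM _ ⟨by positivity, ?_⟩) (abs_nonneg _)
        have : (i:ℝ) < k + 1 := by exact_mod_cast Finset.mem_range.1 hi
        simp only [hw]
        rw [div_le_one (by positivity)]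
        exact this.le
    _ ≤ _ := by
        rw [← Finset.mul_sum]
        nlinarith

abbrev E2 := EuclideanSpace ℝ (Fin 2)

lemma polyfun_diff (p : MvPolynomial (Fin 2) ℝ) :
    Differentiable ℝ (fun x : E2 => MvPolynomial.eval (fun i => x i) p) := by
  induction p using MvPolynomial.induction_on with
  | C a => simp
  | add p q hp hq =>
    simp only [map_add]
    exact hp.add hq
  | mul_X p i hp =>
    simp only [map_mul, MvPolynomial.eval_X]
    exact hp.mul (by fun_prop)

lemma line_eval (z d : E2) (t : ℝ) (p : MvPolynomial (Fin 2) ℝ) :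
    (MvPolynomial.aeval (fun i => Polynomial.C (d i) * Polynomial.X + Polynomial.C (z i)) p : Polynomial ℝ).eval t
      = MvPolynomial.eval (fun i => (z + t • d) i) p := by
  induction p using MvPolynomial.induction_on with
  | C a => simp
  | add p q hp hq => rw [map_add, map_add, Polynomial.eval_add, hp, hq]
  | mul_X p i hp =>
    rw [map_mul, map_mul, Polynomial.eval_mul, hp, MvPolynomial.aeval_X, MvPolynomial.eval_X]
    simp only [Polynomial.eval_add, Polynomial.eval_mul, Polynomial.eval_C, Polynomial.eval_X,
      PiLp.add_apply, PiLp.smul_apply, smul_eq_mul]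
    ring

lemma markov_dir {k : ℕ} {C : ℝ} (hC : ∀ q : Polynomial ℝ, q.natDegree ≤ k → ∀ M : ℝ,
    (∀ t ∈ Icc (0:ℝ) 1, |q.eval t| ≤ M) → |q.derivative.eval 0| ≤ C * M)
    (p : MvPolynomial (Fin 2) ℝ) (hp : p.totalDegree ≤ k) (z b : E2) (M : ℝ)
    (hM : ∀ t ∈ Icc (0:ℝ) 1, |MvPolynomial.eval (fun i => (z + t • (b - z)) i) p| ≤ M) :
    |fderiv ℝ (fun x : E2 => MvPolynomial.eval (fun i => x i) p) z (b - z)| ≤ C * M := by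
  set q : Polynomial ℝ := MvPolynomial.aeval (fun i => Polynomial.C ((b - z) i) * Polynomial.X + Polynomial.C (z i)) p with hq
  have hev : ∀ t, q.eval t = MvPolynomial.eval (fun i => (z + t • (b - z)) i) p :=
    fun t => line_eval z (b - z) t p
  have hdeg : q.natDegree ≤ k := by
    have h := MvPolynomial.aeval_natDegree_le (n := 1) p hp
      (fun i => Polynomial.C ((b - z) i) * Polynomial.X + Polynomial.C (z i)) ?_
    · rw [mul_one] at h
      exact h
    · intro i
      exact Polynomial.natDegree_linear_le
  have h1 := hC q hdeg M (fun t ht => by rw [hev]; exact hM t ht)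
  have h2 : HasDerivAt (fun t : ℝ => q.eval t) (q.derivative.eval 0) 0 := q.hasDerivAt 0
  have h3 : HasDerivAt (fun t : ℝ => z + t • (b - z)) (b - z) 0 := by
    simpa using ((hasDerivAt_id (0:ℝ)).smul_const (b - z)).const_add z
  have h4 : HasFDerivAt (fun x : E2 => MvPolynomial.eval (fun i => x i) p)
      (fderiv ℝ (fun x : E2 => MvPolynomial.eval (fun i => x i) p) z) (z + (0:ℝ) • (b - z)) := by
    simpa using ((polyfun_diff p) z).hasFDerivAt
  have h5 := h4.comp_hasDerivAt 0 h3
  have h6 : HasDerivAt ((fun x : E2 => MvPolynomial.eval (fun i => x i) p) ∘ fun t : ℝ => z + t • (b - z))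
      (q.derivative.eval 0) 0 :=
    h2.congr_of_eventuallyEq (Filter.Eventually.of_forall fun t => (hev t).symm)
  rw [← h6.unique h5]
  exact h1

lemma markov_grad {k : ℕ} {C : ℝ} (hC : ∀ q : Polynomial ℝ, q.natDegree ≤ k → ∀ M : ℝ,
    (∀ t ∈ Icc (0:ℝ) 1, |q.eval t| ≤ M) → |q.derivative.eval 0| ≤ C * M)
    (p : MvPolynomial (Fin 2) ℝ) (hp : p.totalDegree ≤ k) (S : Set E2) (hS : Convex ℝ S)
    (x : E2) (τ : ℝ) (hτ : 0 < τ) (hb : Metric.ball x τ ⊆ S) (M : ℝ)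
    (hM : ∀ z ∈ S, |MvPolynomial.eval (fun i => z i) p| ≤ M) (z : E2) (hz : z ∈ S)
    (e : E2) (he : ‖e‖ = 1) :
    |fderiv ℝ (fun x : E2 => MvPolynomial.eval (fun i => x i) p) z e| ≤ 2 * C / τ * M := by
  have key : ∀ b ∈ S, |fderiv ℝ (fun x : E2 => MvPolynomial.eval (fun i => x i) p) z (b - z)| ≤ C * M := by
    intro b hb
    exact markov_dir hC p hp z b M fun t ht => hM _ (hS.add_smul_sub_mem hz hb ht)
  have m1 : x + (τ/2) • e ∈ S := hb (by simp [he, norm_smul, abs_of_pos hτ]; linarith)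
  have m2 : x - (τ/2) • e ∈ S := hb (by simp [he, norm_smul, abs_of_pos hτ]; linarith)
  have k1 := key _ m1
  have k2 := key _ m2
  have h3 : fderiv ℝ (fun x : E2 => MvPolynomial.eval (fun i => x i) p) z e = τ⁻¹ *
     (fderiv ℝ (fun x : E2 => MvPolynomial.eval (fun i => x i) p) z (x + (τ/2) • e - z)
      - fderiv ℝ (fun x : E2 => MvPolynomial.eval (fun i => x i) p) z (x - (τ/2) • e - z)) := by
    rw [← map_sub]
    have : x + (τ/2) • e - z - (x - (τ/2) • e - z) = τ • e := by module
    rw [this, map_smul, smul_eq_mul]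
    field_simp
  rw [h3, abs_mul, abs_of_pos (inv_pos.2 hτ)]
  calc _ ≤ τ⁻¹ * (C * M + C * M) := by
        gcongr
        exact (abs_sub _ _).trans (add_le_add k1 k2)
    _ = _ := by ring

lemma right_cell (T : Finset (Finset E2)) (y ω : E2) (r R : ℝ) (hr : r < R)
    (hc : ∀ s ∈ Ico r R, y + s • ω ∈ ⋃ K ∈ T, convexHull ℝ (K : Set E2)) :
    ∃ K ∈ T, ∃ ε > 0, ∀ s ∈ Icc r (r + ε), y + s • ω ∈ convexHull ℝ (K : Set E2) := by
  by_contra! hcon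
  have hK : ∀ K ∈ T, ∀ᶠ s in nhdsWithin r (Ioi r), y + s • ω ∉ convexHull ℝ (K : Set E2) := by
    intro K hKT
    by_contra hnot
    have hfr : ∃ᶠ s in nhdsWithin r (Ioi r), y + s • ω ∈ convexHull ℝ (K : Set E2) := by
      exact (Filter.not_eventually.1 hnot).mono fun s hs => not_not.1 hs
    set I : Set ℝ := {s | y + s • ω ∈ convexHull ℝ (K : Set E2)} with hI
    have hclosed : IsClosed I :=
      (K.finite_toSet.isClosed_convexHull ℝ).preimage (by fun_prop : Continuous fun s : ℝ => y + s • ω)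
    have hconv : Convex ℝ I := by
      intro a ha b hb u w hu hw huw
      have := (convex_convexHull ℝ (K : Set E2)) ha hb hu hw huw
      simp only [hI, mem_ofPred_eq]
      convert this using 1
      have : y = (u + w) • y := by rw [huw, one_smul]
      conv_lhs => rw [this]
      simp only [smul_eq_mul]
      module
    have hrI : r ∈ I := by
      rw [← hclosed.closure_eq, mem_closure_iff_frequently]
      exact hfr.filter_mono nhdsWithin_le_nhds
    obtain ⟨s, hs, hsr⟩ := (hfr.and_eventually self_mem_nhdsWithin).exists
    obtain ⟨u, hu, hu'⟩ := hcon K hKT (s - r) (sub_pos.2 hsr)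
    apply hu'
    have : u ∈ I := hconv.ordConnected.out hrI hs ⟨hu.1, by linarith [hu.2]⟩
    exact this
  have hall : ∀ᶠ s in nhdsWithin r (Ioi r), ∀ K ∈ T, y + s • ω ∉ convexHull ℝ (K : Set E2) :=
    (Filter.eventually_all_finset T).2 hK
  have hlt : ∀ᶠ s in nhdsWithin r (Ioi r), s ∈ Ioo r R := Ioo_mem_nhdsGT hr
  obtain ⟨s, hs, hs'⟩ := (hall.and hlt).exists
  have := hc s ⟨hs'.1.le, hs'.2⟩
  simp only [mem_iUnion] at this
  obtain ⟨K, hKT, hm⟩ := this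
  exact hs K hKT hm

def CellProp (T : Finset (Finset E2)) (v : E2 → ℝ) (L : ℝ) : Prop :=
  ∀ K ∈ T, ∃ p : MvPolynomial (Fin 2) ℝ,
    (∀ x ∈ convexHull ℝ (K : Set E2), v x = MvPolynomial.eval (fun i => x i) p) ∧
    ∀ z ∈ convexHull ℝ (K : Set E2), ∀ e : E2, ‖e‖ = 1 →
      |fderiv ℝ (fun x : E2 => MvPolynomial.eval (fun i => x i) p) z e| ≤ L

lemma ray_deriv {T : Finset (Finset E2)} {v : E2 → ℝ} {L : ℝ} (hcell : CellProp T v L)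
    (y ω : E2) (hω : ‖ω‖ = 1) (r R : ℝ) (hr : r < R)
    (hc : ∀ s ∈ Ico r R, y + s • ω ∈ ⋃ K ∈ T, convexHull ℝ (K : Set E2)) :
    ∃ d, HasDerivWithinAt (fun s : ℝ => v (y + s • ω)) d (Ici r) r ∧ |d| ≤ L ∧
      (y + r • ω ∉ (⋃ K ∈ T, frontier (convexHull ℝ (K : Set E2))) →
        |d| ≤ ‖fderiv ℝ v (y + r • ω)‖) := by
  obtain ⟨K, hKT, ε, hε, hK⟩ := right_cell T y ω r R hr hc
  obtain ⟨p, hp, hL⟩ := hcell K hKT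
  have hrK : y + r • ω ∈ convexHull ℝ (K : Set E2) := hK r ⟨le_rfl, by linarith⟩
  set P := fun x : E2 => MvPolynomial.eval (fun i => x i) p with hP
  refine ⟨fderiv ℝ P (y + r • ω) ω, ?_, hL _ hrK ω hω, ?_⟩
  · have h3 : HasDerivAt (fun t : ℝ => y + t • ω) ω r := by
      simpa using ((hasDerivAt_id r).smul_const ω).const_add y
    have h5 := ((polyfun_diff p) (y + r • ω)).hasFDerivAt.comp_hasDerivAt r h3
    refine (h5.hasDerivWithinAt (s := Ici r)).congr_of_eventuallyEq ?_ (hp _ hrK)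
    filter_upwards [Icc_mem_nhdsGE (show r < r + ε by linarith)] with s hs
    exact hp _ (hK s hs)
  · intro hN
    have hint : y + r • ω ∈ interior (convexHull ℝ (K : Set E2)) := by
      by_contra hni
      apply hN
      simp only [mem_iUnion]
      exact ⟨K, hKT, subset_closure hrK, hni⟩
    have heq : v =ᶠ[nhds (y + r • ω)] P := by
      filter_upwards [mem_interior_iff_mem_nhds.1 hint] with z hz using hp z hz
    rw [heq.fderiv_eq]
    have := (fderiv ℝ P (y + r • ω)).le_opNorm ω
    rwa [hω, mul_one] at this

lemma ray_lip {T : Finset (Finset E2)} {v : E2 → ℝ} {L : ℝ} (hv : Continuous v) (hcell : CellProp T v L)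
    (y ω : E2) (hω : ‖ω‖ = 1) (R : ℝ) 
    (hc : ∀ s ∈ Ico 0 R, y + s • ω ∈ ⋃ K ∈ T, convexHull ℝ (K : Set E2)) :
    ∀ s ∈ Icc 0 R, |v (y + s • ω) - v y| ≤ L * s := by
  have key : ∀ r : ℝ, ∃ d, r ∈ Ico 0 R → HasDerivWithinAt (fun s : ℝ => v (y + s • ω)) d (Ici r) r ∧ |d| ≤ L := by
    intro r
    by_cases hr : r ∈ Ico 0 R
    · obtain ⟨d, h1, h2, -⟩ := ray_deriv hcell y ω hω r R hr.2 fun s hs => hc s ⟨hr.1.trans hs.1, hs.2⟩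
      exact ⟨d, fun _ => ⟨h1, h2⟩⟩
    · exact ⟨0, fun h => absurd h hr⟩
  choose d hd using key
  have := norm_image_sub_le_of_norm_deriv_right_le_segment (f := fun s : ℝ => v (y + s • ω))
    (a := 0) (b := R) (f' := d) (C := L) (by fun_prop) (fun x hx => (hd x hx).1) (fun x hx => (hd x hx).2)
  intro s hs
  simpa using this s hs

lemma grad_bound {T : Finset (Finset E2)} {v : E2 → ℝ} {L : ℝ} (hL : 0 ≤ L) (hv : Continuous v) (hcell : CellProp T v L)
    (Ω : Set E2) (hΩ : IsOpen Ω) (hsub : Ω ⊆ ⋃ K ∈ T, convexHull ℝ (K : Set E2)) (z : E2) (hz : z ∈ Ω) :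
    ‖fderiv ℝ v z‖ ≤ L := by
  obtain ⟨ε, hε, hball⟩ := Metric.isOpen_iff.1 hΩ z hz
  refine norm_fderiv_le_of_lip' ℝ hL ?_
  filter_upwards [Metric.ball_mem_nhds z hε] with x hx
  by_cases hxz : x = z
  · simp [hxz]
  have hpos : 0 < ‖x - z‖ := norm_pos_iff.2 (sub_ne_zero.2 hxz)
  have hω : ‖(‖x - z‖⁻¹) • (x - z)‖ = 1 := by
    rw [norm_smul, norm_inv, norm_norm, inv_mul_cancel₀ hpos.ne']
  have h := ray_lip hv hcell z _ hω ‖x - z‖ (fun s hs => hsub (hball ?_)) ‖x - z‖ ⟨hpos.le, le_rfl⟩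
  · rw [smul_smul, mul_inv_cancel₀ hpos.ne', one_smul, add_sub_cancel] at h
    exact h
  · rw [Metric.mem_ball, dist_eq_norm, add_sub_cancel_left, norm_smul, hω, mul_one, Real.norm_eq_abs, abs_of_nonneg hs.1]
    rw [Metric.mem_ball, dist_eq_norm] at hx
    exact hs.2.trans hx

open Classical in
/-- squared gradient density, infinite on the skeleton -/
def gradDens (T : Finset (Finset E2)) (v : E2 → ℝ) (z : E2) : ENNReal :=
  if z ∈ (⋃ K ∈ T, frontier (convexHull ℝ (K : Set E2))) then ⊤ else ENNReal.ofReal (‖fderiv ℝ v z‖ ^ 2)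

lemma gradDens_meas (T : Finset (Finset E2)) (v : E2 → ℝ) : Measurable (gradDens T v) := by
  classical
  unfold gradDens
  refine Measurable.ite ?_ measurable_const ?_
  · exact Finset.measurableSet_biUnion _ fun K _ => isClosed_frontier.measurableSet
  · exact ((measurable_fderiv ℝ v).norm.pow_const 2).ennreal_ofReal

lemma gradDens_ae (T : Finset (Finset E2)) (v : E2 → ℝ) :
    gradDens T v =ᵐ[volume] fun z => ENNReal.ofReal (‖fderiv ℝ v z‖ ^ 2) := by
  have h0 : volume (⋃ K ∈ T, frontier (convexHull ℝ (K : Set E2))) = 0 := by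
    refine (measure_biUnion_null_iff T.countable_toSet).2 ?_
    intro K _
    exact (convex_convexHull ℝ _).addHaar_frontier volume
  filter_upwards [measure_eq_zero_iff_ae_notMem.1 h0] with z hz
  simp [gradDens, hz]

lemma exit_time (Ω : Set E2) (hΩ : IsOpen Ω) (y ω : E2) (hω : ‖ω‖ = 1) (hy : y ∈ Ω) (R0 : ℝ)
    (hR0 : Ω ⊆ Metric.ball y R0) :
    ∃ R, 0 < R ∧ R ≤ R0 ∧ (∀ s ∈ Ico 0 R, y + s • ω ∈ Ω) ∧ y + R • ω ∈ frontier Ω := by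
  have hR0pos : 0 < R0 := Metric.pos_of_mem_ball (hR0 hy)
  set A : Set ℝ := {s | 0 ≤ s ∧ y + s • ω ∉ Ω} with hA
  have hcont : Continuous fun s : ℝ => y + s • ω := by fun_prop
  have hAc : IsClosed A := by
    have : A = Ici 0 ∩ (fun s : ℝ => y + s • ω) ⁻¹' Ωᶜ := by ext; simp [hA]
    rw [this]
    exact isClosed_Ici.inter (hΩ.isClosed_compl.preimage hcont)
  have hmem : R0 ∈ A := by
    refine ⟨hR0pos.le, fun h => ?_⟩
    have := hR0 h
    rw [Metric.mem_ball, dist_eq_norm, add_sub_cancel_left, norm_smul, hω, mul_one, Real.norm_eq_abs, abs_of_pos hR0pos] at this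
    exact lt_irrefl _ this
  have hbdd : BddBelow A := ⟨0, fun s hs => hs.1⟩
  have hin : sInf A ∈ A := hAc.csInf_mem ⟨_, hmem⟩ hbdd
  have hpos : 0 < sInf A := by
    refine lt_of_le_of_ne hin.1 fun h => ?_
    have := hin.2
    rw [← h] at this
    simp [hy] at this
  have hlt : ∀ s ∈ Ico 0 (sInf A), y + s • ω ∈ Ω := by
    intro s hs
    by_contra hcon
    exact absurd (csInf_le hbdd (show s ∈ A from ⟨hs.1, hcon⟩)) (not_le.2 hs.2)
  refine ⟨sInf A, hpos, csInf_le hbdd hmem, hlt, ?_⟩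
  rw [hΩ.frontier_eq]
  refine ⟨?_, hin.2⟩
  have hcl : sInf A ∈ closure (Ico 0 (sInf A)) := by
    rw [closure_Ico hpos.ne]; exact ⟨hpos.le, le_rfl⟩
  exact map_mem_closure (f := fun s : ℝ => y + s • ω) hcont hcl hlt

lemma ray_main {T : Finset (Finset E2)} {v : E2 → ℝ} {L : ℝ} (hv : Continuous v) (hcell : CellProp T v L)
    (Ω : Set E2) (hΩ : IsOpen Ω) (hsub : Ω ⊆ ⋃ K ∈ T, convexHull ℝ (K : Set E2))
    (hfr : ∀ x ∈ frontier Ω, v x = 0) (y ω : E2) (hω : ‖ω‖ = 1) (hy : y ∈ Ω) (R0 : ℝ)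
    (hR0 : Ω ⊆ Metric.ball y R0) (M : ℝ) (hM : 0 < M) (hvy : |v y| = M) (δ : ℝ) (hδ : 0 < δ)
    (hδL : L * δ = M / 2) :
    0 < Real.log (R0 / δ) ∧ ENNReal.ofReal (M ^ 2 / (4 * Real.log (R0 / δ))) ≤
      ∫⁻ r in Ioi (0:ℝ), ENNReal.ofReal r * Ω.indicator (gradDens T v) (y + r • ω) := by
  obtain ⟨R, hRpos, hRR0, hin, hRfr⟩ := exit_time Ω hΩ y ω hω hy R0 hR0
  have hlip := ray_lip hv hcell y ω hω R fun s hs => hsub (hin s hs)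
  have hvR : v (y + R • ω) = 0 := hfr _ hRfr
  have hLpos : 0 < L := by
    by_contra hcon
    nlinarith
  have hδR : δ < R := by
    have := hlip R ⟨hRpos.le, le_rfl⟩
    rw [hvR, zero_sub, abs_neg, hvy] at this
    by_contra hcon
    nlinarith
  have hgδ : M / 2 ≤ |v (y + δ • ω)| := by
    have h1 := hlip δ ⟨hδ.le, hδR.le⟩
    have h2 := abs_sub_abs_le_abs_sub (v y) (v (y + δ • ω))
    rw [abs_sub_comm] at h1
    linarith
  set g : ℝ → ℝ := fun s => v (y + s • ω) with hg
  set φ : ℝ → ℝ := fun s => derivWithin g (Ioi s) s with hφ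
  have hφm : Measurable φ := measurable_derivWithin_Ioi g
  have hder : ∀ r ∈ Ico 0 R, HasDerivWithinAt g (φ r) (Ioi r) r ∧ |φ r| ≤ L ∧
      ENNReal.ofReal (φ r ^ 2) ≤ gradDens T v (y + r • ω) := by
    intro r hr
    obtain ⟨d, h1, h2, h3⟩ := ray_deriv hcell y ω hω r R hr.2 fun s hs => hsub (hin s ⟨hr.1.trans hs.1, hs.2⟩)
    have h4 : HasDerivWithinAt g d (Ioi r) r := h1.mono Ioi_subset_Ici_self
    have h5 : φ r = d := h4.derivWithin (uniqueDiffWithinAt_Ioi r)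
    rw [h5]
    refine ⟨h4, h2, ?_⟩
    unfold gradDens
    split_ifs with hN
    · exact le_top
    · apply ENNReal.ofReal_le_ofReal
      rw [← sq_abs d]
      gcongr
      exact h3 hN
  have hφint : IntervalIntegrable φ volume δ R := by
    rw [intervalIntegrable_iff_integrableOn_Ioo_of_le hδR.le]
    refine Measure.integrableOn_of_bounded (M := L) (by simp) hφm.aestronglyMeasurable ?_
    filter_upwards [ae_restrict_mem measurableSet_Ioo] with r hr
    exact (hder r ⟨hδ.le.trans hr.1.le, hr.2⟩).2.1
  have hsqint : IntegrableOn (fun r => r * φ r ^ 2) (Ioo δ R) volume := by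
    refine Measure.integrableOn_of_bounded (M := R * L ^ 2) (by simp) (by fun_prop) ?_
    filter_upwards [ae_restrict_mem measurableSet_Ioo] with r hr
    have h2 := (hder r ⟨hδ.le.trans hr.1.le, hr.2⟩).2.1
    have hr0 : 0 < r := hδ.trans hr.1
    rw [Real.norm_eq_abs, abs_of_nonneg (by positivity), ← sq_abs (φ r)]
    have := hr.2.le
    gcongr
  have hsqint' : IntervalIntegrable (fun r => r * φ r ^ 2) volume δ R := by
    rwa [intervalIntegrable_iff_integrableOn_Ioo_of_le hδR.le]
  have hinvint : IntervalIntegrable (fun r : ℝ => r⁻¹) volume δ R := by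
    refine ContinuousOn.intervalIntegrable (continuousOn_inv₀.mono fun r hr => ?_)
    rw [uIcc_of_le hδR.le] at hr
    exact (hδ.trans_le hr.1).ne'
  have hftc : ∫ r in δ..R, φ r = g R - g δ :=
    intervalIntegral.integral_eq_sub_of_hasDeriv_right_of_le hδR.le (by fun_prop)
      (fun r hr => (hder r ⟨hδ.le.trans hr.1.le, hr.2⟩).1) hφint
  have hΛ1 : 0 < Real.log (R / δ) := Real.log_pos (by rwa [one_lt_div hδ])
  have hΛ2 : Real.log (R / δ) ≤ Real.log (R0 / δ) :=
    Real.log_le_log (by positivity) (by gcongr)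
  set Λ := Real.log (R0 / δ) with hΛ
  have hΛpos : 0 < Λ := hΛ1.trans_le hΛ2
  set J := ∫ r in δ..R, r * φ r ^ 2 with hJ
  have hJ1 : M ^ 2 / (4 * Λ) ≤ J := by
    have h1 : M / 2 ≤ ∫ r in δ..R, |φ r| := by
      have : |∫ r in δ..R, φ r| = |g δ| := by
        rw [hftc, hg]
        simp only [hvR, zero_sub, abs_neg]
      calc M / 2 ≤ |g δ| := hgδ
        _ = |∫ r in δ..R, φ r| := this.symm
        _ ≤ _ := intervalIntegral.abs_integral_le_integral_abs hδR.le
    set lam := M / (2 * Λ) with hlam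
    have hlampos : 0 < lam := by positivity
    have h2 : ∫ r in δ..R, |φ r| ≤ ∫ r in δ..R, (lam / 2 * r⁻¹ + 1 / (2 * lam) * (r * φ r ^ 2)) := by
      refine intervalIntegral.integral_mono_on hδR.le hφint.abs
        ((hinvint.const_mul _).add (hsqint'.const_mul _)) fun r hr => ?_
      have hr0 : 0 < r := hδ.trans_le hr.1
      have : lam / 2 * r⁻¹ + 1 / (2 * lam) * (r * φ r ^ 2) - |φ r| = (lam - r * |φ r|) ^ 2 / (2 * lam * r) := by
        rw [← sq_abs (φ r)]
        field_simp
        ring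
      have h3 : 0 ≤ (lam - r * |φ r|) ^ 2 / (2 * lam * r) := by positivity
      linarith
    rw [intervalIntegral.integral_add (hinvint.const_mul _) (hsqint'.const_mul _),
      intervalIntegral.integral_const_mul, intervalIntegral.integral_const_mul,
      integral_inv_of_pos hδ hRpos, ← hJ] at h2
    have h3 : lam / 2 * Real.log (R / δ) ≤ M / 4 := by
      calc _ ≤ lam / 2 * Λ := by gcongr
        _ = M / 4 := by rw [hlam]; field_simp; ring
    have h4 : M / 4 ≤ 1 / (2 * lam) * J := by linarith
    have h5 : 1 / (2 * lam) * J = Λ / M * J := by rw [hlam]; field_simp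
    rw [h5] at h4
    rw [div_le_iff₀ (by positivity)]
    have h6 : M / 4 * M ≤ Λ / M * J * M := by gcongr
    have h7 : Λ / M * J * M = Λ * J := by field_simp
    nlinarith
  refine ⟨hΛpos, ?_⟩
  calc ENNReal.ofReal (M ^ 2 / (4 * Λ)) ≤ ENNReal.ofReal J := ENNReal.ofReal_le_ofReal hJ1
    _ = ∫⁻ r in Ioo δ R, ENNReal.ofReal (r * φ r ^ 2) := by
        rw [hJ, intervalIntegral.integral_of_le hδR.le, integral_Ioc_eq_integral_Ioo]
        refine ofReal_integral_eq_lintegral_ofReal hsqint ?_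
        filter_upwards [ae_restrict_mem measurableSet_Ioo] with r hr
        have hr0 : 0 < r := hδ.trans hr.1
        simp only [Pi.zero_apply]
        positivity
    _ ≤ ∫⁻ r in Ioo δ R, ENNReal.ofReal r * Ω.indicator (gradDens T v) (y + r • ω) := by
        refine setLIntegral_mono' measurableSet_Ioo fun r hr => ?_
        have hr' : r ∈ Ico 0 R := ⟨hδ.le.trans hr.1.le, hr.2⟩
        rw [ENNReal.ofReal_mul hr'.1, indicator_of_mem (hin r hr')]
        gcongr
        exact (hder r hr').2.2
    _ ≤ _ := lintegral_mono_set fun r hr => hδ.trans hr.1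

lemma polar_lower (G : E2 → ENNReal) (hG : Measurable G) (y : E2) (c : ENNReal)
    (hc : ∀ ω : E2, ‖ω‖ = 1 → c ≤ ∫⁻ r in Ioi (0:ℝ), ENNReal.ofReal r * G (y + r • ω)) :
    c * ENNReal.ofReal (2 * Real.pi) ≤ ∫⁻ z, G z := by
  set e := Complex.orthonormalBasisOneI.repr with he
  have hmp : MeasurePreserving e volume volume := e.measurePreserving
  have h1 : ∫⁻ z, G z = ∫⁻ w : ℂ, G (y + e w) := by
    rw [hmp.lintegral_comp (f := fun z => G (y + z)) (by fun_prop), lintegral_add_left_eq_self]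
  rw [h1, ← Complex.lintegral_comp_polarCoord_symm, show polarCoord.target = Ioi (0 : ℝ) ×ˢ Ioo (-Real.pi) Real.pi from rfl,
    Measure.volume_eq_prod]
  have hcs : ∀ p : ℝ × ℝ, Complex.polarCoord.symm p = p.1 • ((Real.cos p.2 : ℂ) + Real.sin p.2 * Complex.I) := by
    intro p; rw [Complex.polarCoord_symm_apply, Complex.real_smul]
  simp only [hcs, map_smul]
  rw [setLIntegral_prod_symm]
  · calc c * ENNReal.ofReal (2 * Real.pi) = ∫⁻ θ in Ioo (-Real.pi) Real.pi, c := by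
          rw [setLIntegral_const, Real.volume_Ioo]; congr 2; ring
      _ ≤ _ := by
          refine lintegral_mono fun θ => ?_
          simp only [smul_eq_mul]
          refine hc _ ?_
          rw [LinearIsometryEquiv.norm_map]
          push_cast
          rw [Complex.norm_cos_add_sin_mul_I]
  · have : Continuous e := e.continuous
    refine Measurable.aemeasurable ?_
    simp only [smul_eq_mul]
    refine (by fun_prop : Measurable fun p : ℝ × ℝ => ENNReal.ofReal p.1).mul (hG.comp ?_)
    refine Continuous.measurable ?_
    fun_prop

/-- **Discrete Sobolev inequality in 2D.** For Lagrange finite element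
functions of degree `k` on a quasi-uniform triangulation of a bounded
polygonal domain `Ω ⊆ ℝ²`, vanishing on `∂Ω`, one has
`‖v_h‖_{L^∞(Ω)} ≤ C (1 + |ln h|)^{1/2} ‖v_h‖_{H¹(Ω)}` with `C` independent of
`h`. -/
theorem discrete_sobolev_2d
    (Ω : Set (EuclideanSpace ℝ (Fin 2)))
    (hΩopen : IsOpen Ω) (hΩbdd : Bornology.IsBounded Ω) (hΩne : Ω.Nonempty)
    (hpoly : ∃ F : Finset (Finset (EuclideanSpace ℝ (Fin 2))),
      closure Ω = ⋃ K ∈ F, convexHull ℝ (K : Set (EuclideanSpace ℝ (Fin 2))))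
    (k : ℕ) (hk : 1 ≤ k) (ρ : ℝ) (hρ : 0 < ρ) :
    ∃ C : ℝ, 0 < C ∧
      ∀ h : ℝ, 0 < h → h < 1 →
      ∀ T : Finset (Finset (EuclideanSpace ℝ (Fin 2))),
        IsQuasiUniformMesh 2 Ω T h ρ →
        ∀ v, MemFESpace 2 k Ω T v →
          ∀ x ∈ Ω, |v x| ≤ C * Real.sqrt (1 + |Real.log h|) * h1Norm Ω v := by
  obtain ⟨Ck, hCk1, hCk⟩ := markov_one k
  set R0 : ℝ := Metric.diam Ω + 1 with hR0
  have hR0pos : 0 < R0 := by have := Metric.diam_nonneg (s := Ω); linarith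
  set A : ℝ := 1 + |Real.log (4 * Ck * R0 / ρ)| with hA
  have hApos : 0 < A := by positivity
  refine ⟨Real.sqrt A, Real.sqrt_pos.2 hApos, ?_⟩
  intro h hh hh1 T hT v hv x hx
  obtain ⟨hcov, hT⟩ := hT
  obtain ⟨hvc, hvfr, hvp⟩ := hv
  have hcomp : IsCompact (closure Ω) := hΩbdd.isCompact_closure
  obtain ⟨y, hycl, hymax⟩ := hcomp.exists_isMaxOn hΩne.closure (hvc.abs.continuousOn)
  have hmax : ∀ z ∈ closure Ω, |v z| ≤ |v y| := fun z hz => hymax hz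
  set M := |v y| with hM
  have hxM : |v x| ≤ M := hmax x (subset_closure hx)
  have hnn : 0 ≤ Real.sqrt A * Real.sqrt (1 + |Real.log h|) * h1Norm Ω v := by
    unfold h1Norm; positivity
  rcases (abs_nonneg (v y)).eq_or_lt with hM0 | hMpos
  · rw [hM, ← hM0] at hxM
    exact hxM.trans hnn
  have hy : y ∈ Ω := by
    by_contra hcon
    have : v y = 0 := hvfr y (by rw [hΩopen.frontier_eq]; exact ⟨hycl, hcon⟩)
    rw [this] at hMpos
    simp at hMpos
  have hCkpos : 0 < Ck := by linarith
  set L : ℝ := 2 * Ck / (ρ * h) * M with hL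
  have hLpos : 0 < L := by positivity
  have hcell : CellProp T v L := by
    intro K hK
    obtain ⟨p, hpdeg, hp⟩ := hvp K hK
    obtain ⟨-, -, -, c, hball⟩ := hT K hK
    refine ⟨p, hp, fun z hz e he => ?_⟩
    refine markov_grad hCk p hpdeg _ (convex_convexHull ℝ _) c (ρ * h) (by positivity) hball M
      (fun u hu => ?_) z hz e he
    rw [← hp u hu]
    exact hmax u (hcov ▸ mem_biUnion hK hu)
  have hsub : Ω ⊆ ⋃ K ∈ T, convexHull ℝ (K : Set E2) := hcov ▸ subset_closure
  set δ : ℝ := ρ * h / (4 * Ck) with hδ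
  have hδpos : 0 < δ := by positivity
  have hδL : L * δ = M / 2 := by rw [hL, hδ]; field_simp; ring
  have hball : Ω ⊆ Metric.ball y R0 := by
    intro z hz
    have := Metric.dist_le_diam_of_mem hΩbdd hz hy
    rw [Metric.mem_ball]; linarith
  have hray := fun (ω : E2) (hω : ‖ω‖ = 1) => ray_main hvc hcell Ω hΩopen hsub hvfr y ω hω hy R0 hball M hMpos rfl δ hδpos hδL
  set Λ := Real.log (R0 / δ) with hΛ
  have hΛpos : 0 < Λ := (hray (EuclideanSpace.single 0 1) (by simp)).1
  have hpol := polar_lower (Ω.indicator (gradDens T v))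
    ((gradDens_meas T v).indicator hΩopen.measurableSet) y (ENNReal.ofReal (M ^ 2 / (4 * Λ)))
    (fun ω hω => (hray ω hω).2)
  rw [lintegral_indicator hΩopen.measurableSet,
    lintegral_congr_ae (ae_restrict_of_ae (gradDens_ae T v))] at hpol
  have hint : IntegrableOn (fun z => ‖fderiv ℝ v z‖ ^ 2) Ω volume := by
    refine Measure.integrableOn_of_bounded (M := L ^ 2) hΩbdd.measure_lt_top.ne
      ((measurable_fderiv ℝ v).norm.pow_const 2).aestronglyMeasurable ?_
    filter_upwards [ae_restrict_mem hΩopen.measurableSet] with z hz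
    rw [Real.norm_eq_abs, abs_of_nonneg (by positivity)]
    have := grad_bound hLpos.le hvc hcell Ω hΩopen hsub z hz
    gcongr
  rw [← ofReal_integral_eq_lintegral_ofReal hint (Filter.Eventually.of_forall fun z => by simp),
    ← ENNReal.ofReal_mul (by positivity)] at hpol
  set G := ∫ z in Ω, ‖fderiv ℝ v z‖ ^ 2 with hG
  have hG0 : 0 ≤ G := integral_nonneg fun z => by positivity
  rw [ENNReal.ofReal_le_ofReal_iff hG0] at hpol
  have hMG : M ^ 2 ≤ Λ * G := by
    have h1 : M ^ 2 / (4 * Λ) * (2 * Real.pi) * (4 * Λ) ≤ G * (4 * Λ) := by gcongr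
    have h2 : M ^ 2 / (4 * Λ) * (2 * Real.pi) * (4 * Λ) = 2 * Real.pi * M ^ 2 := by field_simp
    rw [h2] at h1
    nlinarith [Real.pi_gt_three, sq_nonneg M]
  have hΛA : Λ ≤ A * (1 + |Real.log h|) := by
    have h1 : R0 / δ = (4 * Ck * R0 / ρ) / h := by rw [hδ]; field_simp
    rw [hΛ, h1, Real.log_div (by positivity) hh.ne', hA]
    have h2 := le_abs_self (Real.log (4 * Ck * R0 / ρ))
    have h3 := neg_abs_le (Real.log h)
    have h4 := abs_nonneg (Real.log h)
    have h5 := abs_nonneg (Real.log (4 * Ck * R0 / ρ))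
    nlinarith
  have hV0 : 0 ≤ ∫ z in Ω, v z ^ 2 := integral_nonneg fun z => by positivity
  refine hxM.trans ?_
  unfold h1Norm
  rw [← hG, ← Real.sqrt_mul hApos.le, ← Real.sqrt_mul (by positivity)]
  refine Real.le_sqrt_of_sq_le (hMG.trans ?_)
  have : G ≤ (∫ z in Ω, v z ^ 2) + G := by linarith
  gcongr
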